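/- Let n ≥ 1 and let M be an (n+1)×n real lower bidiagonal matrix with positive entries m_{kk} (k=1,…,n) on the main diagonal and m_{k+1,k} (k=1,…,n) on the subdiagonal. Let A be the (2n+1)×(2n+1) block matrix [[0, M],[Mᵀ, 0]]. Let P be the (2n+1)×(2n+1) perfect shuffle permutation matrix with P_{ij}=1 iff j=2i−1 (for 1≤i≤n+1) or j=2(i−(n+1)) (for n+2≤i≤2n+1), and let D be the (2n+1)×(2n+1) diagonal matrix with (i,i) entry n^{−(i−1)/2} ∏_{k=1}^{⌊i/2⌋} m_{kk} ∏_{k=1}^{⌊(i−1)/2⌋} m_{k+1,k}. Then D Pᵀ A P D^{−1} is tridiagonal with zero main diagonal, every superdiagonal entry equal to √n, and subdiagonal entries given by (2j, 2j−1) entry = m_{jj}²/√n for j=1,…,n and (2j+1, 2j) entry = m_{j+1,j}²/√n for j=1,…,n. -/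

import Mathlib

open Matrix Real Finset

/-- The perfect shuffle as a map into the two blocks: even (0-based) positions go to the first
block, odd positions to the second. -/
def unshuffle (n : ℕ) (i : Fin (2 * n + 1)) : Fin (n + 1) ⊕ Fin n :=
  if h : (i : ℕ) % 2 = 0 then Sum.inl ⟨(i : ℕ) / 2, by omega⟩
  else Sum.inr ⟨(i : ℕ) / 2, by omega⟩

theorem unshuffle_even {n : ℕ} {i : Fin (2 * n + 1)} {k : ℕ} (h : (i : ℕ) = 2 * k) :
    unshuffle n i = Sum.inl ⟨k, by omega⟩ := by
  rw [unshuffle, dif_pos (by omega)]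
  congr 2
  omega

theorem unshuffle_odd {n : ℕ} {i : Fin (2 * n + 1)} {k : ℕ} (h : (i : ℕ) = 2 * k + 1) :
    unshuffle n i = Sum.inr ⟨k, by omega⟩ := by
  rw [unshuffle, dif_neg (by omega)]
  congr 2
  omega

theorem diagonal_mul_selection_conj_apply {ι R : Type*} [Fintype ι] [DecidableEq ι] [Field R]
    (σ : ι → ι) (A : Matrix ι ι R) (d : ι → R) (hd : ∀ i, d i ≠ 0) (i j : ι) :
    (Matrix.diagonal d * (Matrix.of fun i j => if i = σ j then (1 : R) else 0)ᵀ * A *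
      (Matrix.of fun i j => if i = σ j then (1 : R) else 0) * (Matrix.diagonal d)⁻¹) i j =
      d i * A (σ i) (σ j) * (d j)⁻¹ := by
  have hinv : (Matrix.diagonal d)⁻¹ = Matrix.diagonal fun i => (d i)⁻¹ := by
    apply Matrix.inv_eq_right_inv
    simp [Matrix.diagonal_mul_diagonal, hd]
  rw [hinv, Matrix.mul_diagonal, Matrix.mul_assoc, Matrix.mul_assoc, Matrix.diagonal_mul]
  simp [Matrix.mul_apply]

/-- The scaling weights attached to the diagonal `a` and the subdiagonal `b`. -/
noncomputable def shuffleWeight (n : ℕ) (a b : ℕ → ℝ) (i : ℕ) : ℝ :=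
  (n : ℝ) ^ (-(i : ℝ) / 2) * (∏ k ∈ range ((i + 1) / 2), a k) * (∏ k ∈ range (i / 2), b k)

theorem rpow_neg_succ_half {x : ℝ} (hx : 0 < x) (i : ℕ) :
    x ^ (-((i + 1 : ℕ) : ℝ) / 2) = x ^ (-(i : ℝ) / 2) / √x := by
  rw [Real.sqrt_eq_rpow, ← Real.rpow_sub hx]
  congr 1
  push_cast
  ring

theorem shuffleWeight_odd {n : ℕ} (hn : 1 ≤ n) (a b : ℕ → ℝ) (k : ℕ) :
    shuffleWeight n a b (2 * k + 1) = shuffleWeight n a b (2 * k) * a k / √n := by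
  have hn' : (0 : ℝ) < n := by exact_mod_cast hn
  rw [shuffleWeight, shuffleWeight, rpow_neg_succ_half hn',
    show (2 * k + 1 + 1) / 2 = k + 1 by omega, show (2 * k + 1) / 2 = k by omega,
    show 2 * k / 2 = k by omega, prod_range_succ]
  ring

theorem shuffleWeight_even {n : ℕ} (hn : 1 ≤ n) (a b : ℕ → ℝ) (k : ℕ) :
    shuffleWeight n a b (2 * k + 2) = shuffleWeight n a b (2 * k + 1) * b k / √n := by
  have hn' : (0 : ℝ) < n := by exact_mod_cast hn
  rw [shuffleWeight, shuffleWeight, rpow_neg_succ_half hn',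
    show (2 * k + 1 + 1 + 1) / 2 = k + 1 by omega, show (2 * k + 1 + 1) / 2 = k + 1 by omega,
    show (2 * k + 1) / 2 = k by omega, prod_range_succ b]
  ring

theorem shuffleWeight_pos {n : ℕ} (hn : 1 ≤ n) {a b : ℕ → ℝ} (ha : ∀ k, 0 < a k)
    (hb : ∀ k, 0 < b k) (i : ℕ) : 0 < shuffleWeight n a b i := by
  have hn' : (0 : ℝ) < n := by exact_mod_cast hn
  exact mul_pos (mul_pos (Real.rpow_pos_of_pos hn' _) (prod_pos fun k _ => ha k))
    (prod_pos fun k _ => hb k)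

/-- the perfect-shuffle identity underlying the rectangular
Laguerre matrix model at the soft edge: for an `(n+1)×n` lower bidiagonal `M`
with positive bidiagonal entries, `D Pᵀ [[0,M],[Mᵀ,0]] P D⁻¹` is tridiagonal
with zero diagonal, superdiagonal entries `√n`, and subdiagonal entries
`m_{jj}²/√n` at `(2j,2j−1)` and `m_{j+1,j}²/√n` at `(2j+1,2j)`
(1-based indexing in this description). -/
theorem laguerre_rectangular_perfect_shuffle (n : ℕ) (hn : 1 ≤ n)
    (M : Matrix (Fin (n + 1)) (Fin n) ℝ)
    (hMbd : ∀ (i : Fin (n + 1)) (j : Fin n),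
      (i : ℕ) ≠ (j : ℕ) → (i : ℕ) ≠ (j : ℕ) + 1 → M i j = 0)
    (hMdiag : ∀ j : Fin n, 0 < M j.castSucc j)
    (hMsub : ∀ j : Fin n, 0 < M j.succ j)
    (A : Matrix (Fin (2 * n + 1)) (Fin (2 * n + 1)) ℝ)
    (hA : A = Matrix.reindex (finSumFinEquiv.trans (finCongr (by omega : n + 1 + n = 2 * n + 1)))
      (finSumFinEquiv.trans (finCongr (by omega : n + 1 + n = 2 * n + 1)))
      (Matrix.fromBlocks 0 M Mᵀ 0))
    (P : Matrix (Fin (2 * n + 1)) (Fin (2 * n + 1)) ℝ)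
    (hP : P = Matrix.of fun (i j : Fin (2 * n + 1)) =>
      if ((i : ℕ) < n + 1 ∧ (j : ℕ) = 2 * (i : ℕ)) ∨
          (n + 1 ≤ (i : ℕ) ∧ (j : ℕ) = 2 * ((i : ℕ) - (n + 1)) + 1) then 1 else 0)
    (D : Matrix (Fin (2 * n + 1)) (Fin (2 * n + 1)) ℝ)
    (hD : D = Matrix.diagonal (fun i : Fin (2 * n + 1) =>
      (n : ℝ) ^ (-(((i : ℕ) : ℝ)) / 2) *
        (∏ k ∈ (Finset.range (((i : ℕ) + 1) / 2)).attach,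
          M ⟨k.1, by have := Finset.mem_range.mp k.2; have := i.isLt; omega⟩
            ⟨k.1, by have := Finset.mem_range.mp k.2; have := i.isLt; omega⟩) *
        (∏ k ∈ (Finset.range ((i : ℕ) / 2)).attach,
          M ⟨k.1 + 1, by have := Finset.mem_range.mp k.2; have := i.isLt; omega⟩
            ⟨k.1, by have := Finset.mem_range.mp k.2; have := i.isLt; omega⟩))) :
    (∀ i j : Fin (2 * n + 1), (i : ℕ) + 1 < (j : ℕ) ∨ (j : ℕ) + 1 < (i : ℕ) →
      (D * Pᵀ * A * P * D⁻¹) i j = 0) ∧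
    (∀ i : Fin (2 * n + 1), (D * Pᵀ * A * P * D⁻¹) i i = 0) ∧
    (∀ i j : Fin (2 * n + 1), (j : ℕ) = (i : ℕ) + 1 →
      (D * Pᵀ * A * P * D⁻¹) i j = Real.sqrt n) ∧
    (∀ j : Fin n,
      (D * Pᵀ * A * P * D⁻¹) ⟨2 * (j : ℕ) + 1, by have := j.isLt; omega⟩
          ⟨2 * (j : ℕ), by have := j.isLt; omega⟩
        = (M j.castSucc j) ^ 2 / Real.sqrt n) ∧
    (∀ j : Fin n,
      (D * Pᵀ * A * P * D⁻¹) ⟨2 * (j : ℕ) + 2, by have := j.isLt; omega⟩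
          ⟨2 * (j : ℕ) + 1, by have := j.isLt; omega⟩
        = (M j.succ j) ^ 2 / Real.sqrt n) := by
  have hn' : (0 : ℝ) < √n := Real.sqrt_pos.mpr (by exact_mod_cast hn)
  set e : Fin (n + 1) ⊕ Fin n ≃ Fin (2 * n + 1) :=
    finSumFinEquiv.trans (finCongr (by omega : n + 1 + n = 2 * n + 1)) with he
  have hP' : P = Matrix.of fun i j => if i = e (unshuffle n j) then (1 : ℝ) else 0 := by
    rw [hP]
    ext i j
    simp only [Matrix.of_apply]
    congr 1
    apply propext
    rcases Nat.even_or_odd' (j : ℕ) with ⟨k, hk | hk⟩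
    · rw [unshuffle_even hk, Fin.ext_iff]
      simp [he]
      omega
    · rw [unshuffle_odd hk, Fin.ext_iff]
      simp [he]
      omega
  let a : ℕ → ℝ := fun k => if h : k < n then M ⟨k, by omega⟩ ⟨k, h⟩ else 1
  let b : ℕ → ℝ := fun k => if h : k < n then M ⟨k + 1, by omega⟩ ⟨k, h⟩ else 1
  have ha_eq : ∀ k (h : k < n), a k = M ⟨k, by omega⟩ ⟨k, h⟩ := fun k h => dif_pos h
  have hb_eq : ∀ k (h : k < n), b k = M ⟨k + 1, by omega⟩ ⟨k, h⟩ := fun k h => dif_pos h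
  have ha : ∀ k, 0 < a k := fun k => by
    by_cases h : k < n
    · rw [ha_eq k h]; exact hMdiag ⟨k, h⟩
    · simp [a, h]
  have hb : ∀ k, 0 < b k := fun k => by
    by_cases h : k < n
    · rw [hb_eq k h]; exact hMsub ⟨k, h⟩
    · simp [b, h]
  have hD' : D = Matrix.diagonal fun i : Fin (2 * n + 1) => shuffleWeight n a b i := by
    rw [hD]
    congr 1
    funext i
    rw [shuffleWeight, ← prod_attach (range (((i : ℕ) + 1) / 2)),
      ← prod_attach (range ((i : ℕ) / 2))]
    congr 1
    · congr 1
      refine prod_congr rfl fun k _ => (ha_eq k.1 ?_).symm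
      have := mem_range.mp k.2
      omega
    · refine prod_congr rfl fun k _ => (hb_eq k.1 ?_).symm
      have := mem_range.mp k.2
      omega
  have hw : ∀ i, shuffleWeight n a b i ≠ 0 := fun i => (shuffleWeight_pos hn ha hb i).ne'
  have key : ∀ i j, (D * Pᵀ * A * P * D⁻¹) i j = shuffleWeight n a b i *
      Matrix.fromBlocks 0 M Mᵀ 0 (unshuffle n i) (unshuffle n j) *
        (shuffleWeight n a b j)⁻¹ := by
    intro i j
    rw [hD', hP', diagonal_mul_selection_conj_apply (fun j => e (unshuffle n j)) A _
      (fun i => hw i), hA]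
    simp
  simp only [key]
  refine ⟨fun i j hij => ?_, fun i => ?_, fun i j hij => ?_, fun j => ?_, fun j => ?_⟩
  · rcases Nat.even_or_odd' (i : ℕ) with ⟨k, hk | hk⟩ <;>
      rcases Nat.even_or_odd' (j : ℕ) with ⟨l, hl | hl⟩
    · simp [unshuffle_even hk, unshuffle_even hl]
    · rw [unshuffle_even hk, unshuffle_odd hl, Matrix.fromBlocks_apply₁₂,
        hMbd _ _ (by simp only; omega) (by simp only; omega)]
      simp
    · rw [unshuffle_odd hk, unshuffle_even hl, Matrix.fromBlocks_apply₂₁, Matrix.transpose_apply,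
        hMbd _ _ (by simp only; omega) (by simp only; omega)]
      simp
    · simp [unshuffle_odd hk, unshuffle_odd hl]
  · rcases Nat.even_or_odd' (i : ℕ) with ⟨k, hk | hk⟩
    · simp [unshuffle_even hk]
    · simp [unshuffle_odd hk]
  · rcases Nat.even_or_odd' (i : ℕ) with ⟨k, hk | hk⟩
    · have hj : (j : ℕ) = 2 * k + 1 := by omega
      rw [unshuffle_even hk, unshuffle_odd hj, Matrix.fromBlocks_apply₁₂, ← ha_eq k (by omega),
        hk, hj, shuffleWeight_odd hn]
      have := hw (2 * k)
      have := (ha k).ne'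
      field_simp
    · have hj : (j : ℕ) = 2 * (k + 1) := by omega
      rw [unshuffle_odd hk, unshuffle_even hj, Matrix.fromBlocks_apply₂₁, Matrix.transpose_apply,
        ← hb_eq k (by omega), hk, hj, mul_add, mul_one, shuffleWeight_even hn]
      have := hw (2 * k + 1)
      have := (hb k).ne'
      field_simp
  · rw [unshuffle_odd (k := j) rfl, unshuffle_even (k := j) rfl, Matrix.fromBlocks_apply₂₁,
      Matrix.transpose_apply, show M j.castSucc j = a j from (ha_eq j j.isLt).symm,
      ← ha_eq j j.isLt, shuffleWeight_odd hn]
    have := hw (2 * j)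
    field_simp
  · rw [unshuffle_even (k := j + 1) rfl, unshuffle_odd (k := j) rfl, Matrix.fromBlocks_apply₁₂,
      show M j.succ j = b j from (hb_eq j j.isLt).symm,
      ← hb_eq j j.isLt, shuffleWeight_even hn]
    have := hw (2 * j + 1)
    field_simp
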